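/- Let t_0, …, t_{n−1} be an open n-shell with n ≥ 5, with structural vertices a_i and b_i. If a_0 = b_3 and b_2 = a_3, then n ≤ 6, and if n = 6 then moreover a_2 = b_5. -/

import Mathlib

/-- An open `n`-shell: a family `t 0, …, t (n-1)` of 3-element subsets of the
vertex type `V` such that consecutive triangles share exactly two vertices and
non-consecutive triangles share exactly one vertex. -/
def IsOpenShell {V : Type*} [DecidableEq V] (n : ℕ) (t : ℕ → Finset V) : Prop :=
  (∀ i < n, (t i).card = 3) ∧
  (∀ i, i + 1 < n → (t i ∩ t (i + 1)).card = 2) ∧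
  (∀ i j, j < n → i + 2 ≤ j → (t i ∩ t j).card = 1)

/-- In an open `n`-shell with `n ≥ 5`, with structural vertices `a i` (the
unique element of `t i \ t (i+1)`) and `b i` (the unique element of
`t i \ t (i-1)`): if `a 0 = b 3` and `b 2 = a 3`, then `n ≤ 6`, and if
`n = 6` then moreover `a 2 = b 5`. -/
theorem openShell_repetition_pattern_c {V : Type*} [DecidableEq V]
    (n : ℕ) (hn : 5 ≤ n) (t : ℕ → Finset V) (hshell : IsOpenShell n t)
    (a b : ℕ → V)
    (ha : ∀ i, i + 1 < n → t i \ t (i + 1) = {a i})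
    (hb : ∀ i, 1 ≤ i → i < n → t i \ t (i - 1) = {b i})
    (h1 : a 0 = b 3) (h2 : b 2 = a 3) :
    n ≤ 6 ∧ (n = 6 → a 2 = b 5) := by
  obtain ⟨-, -, hs⟩ := hshell
  -- in fact `n ≤ 5`
  suffices h : ¬ 6 ≤ n by omega
  intro h6
  have A : ∀ i, i + 1 < n → ∀ v, (v ∈ t i ∧ v ∉ t (i + 1)) ↔ v = a i := by
    intro i hi v
    rw [← Finset.mem_sdiff, ha i hi, Finset.mem_singleton]
  have B : ∀ i, i + 1 < n → ∀ v, (v ∈ t (i + 1) ∧ v ∉ t i) ↔ v = b (i + 1) := by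
    intro i hi v
    have := hb (i + 1) (by omega) hi
    rw [Nat.add_sub_cancel] at this
    rw [← Finset.mem_sdiff, this, Finset.mem_singleton]
  have U : ∀ i j, j < n → i + 2 ≤ j → ∀ u v, u ∈ t i → u ∈ t j → v ∈ t i → v ∈ t j →
      u = v := by
    intro i j hj hij u v h1 h2 h3 h4
    exact Finset.card_le_one.mp (hs i j hj hij).le u (Finset.mem_inter.mpr ⟨h1, h2⟩) v
      (Finset.mem_inter.mpr ⟨h3, h4⟩)
  have E : ∀ i j, j < n → i + 2 ≤ j → ∃ u, u ∈ t i ∧ u ∈ t j := by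
    intro i j hj hij
    obtain ⟨u, hu⟩ := Finset.card_pos.mp (by rw [hs i j hj hij]; exact one_pos)
    exact ⟨u, Finset.mem_inter.mp hu⟩
  have A0 := A 0 (by omega)
  have A3 := A 3 (by omega)
  have A4 := A 4 (by omega)
  have B1 := B 0 (by omega)
  have B2 := B 1 (by omega)
  have B3 := B 2 (by omega)
  have B5 := B 4 (by omega)
  norm_num at A0 A3 A4 B1 B2 B3 B5
  obtain ⟨x0, x1⟩ := (A0 (a 0)).2 rfl
  obtain ⟨x3, x2⟩ := (B3 (a 0)).2 h1
  obtain ⟨y2, y1⟩ := (B2 (b 2)).2 rfl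
  obtain ⟨y3, y4⟩ := (A3 (b 2)).2 h2
  obtain ⟨c, c1, c3⟩ := E 1 3 (by omega) (by omega)
  have cx : c ≠ a 0 := fun h => x1 (h ▸ c1)
  have cy : c ≠ b 2 := fun h => y1 (h ▸ c1)
  have xy : a 0 ≠ b 2 := fun h => x2 (h ▸ y2)
  have c0 : c ∉ t 0 := fun h => cx (U 0 3 (by omega) (by omega) _ _ h c3 x0 x3)
  have c4 : c ∈ t 4 := by
    by_contra h
    exact cy (((A3 c).1 ⟨c3, h⟩).trans h2.symm)
  have x4 : a 0 ∈ t 4 := by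
    by_contra h
    exact xy (((A3 _).1 ⟨x3, h⟩).trans h2.symm)
  obtain ⟨u, u0, u5⟩ := E 0 5 (by omega) (by omega)
  obtain ⟨v, v1, v5⟩ := E 1 5 (by omega) (by omega)
  by_cases x5 : a 0 ∈ t 5
  · have v0 : v ∈ t 0 := by
      by_contra h
      have hvc : v = c := ((B1 v).1 ⟨v1, h⟩).trans ((B1 c).1 ⟨c1, c0⟩).symm
      subst hvc
      exact cx (U 3 5 (by omega) (by omega) _ _ c3 v5 x3 x5)
    have := U 0 5 (by omega) (by omega) _ _ v0 v5 x0 x5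
    exact x1 (this ▸ v1)
  · have u1 : u ∈ t 1 := by
      by_contra h
      exact x5 (((A0 u).1 ⟨u0, h⟩) ▸ u5)
    have c5 : c ∈ t 5 := by
      by_contra h
      exact cx (((A4 c).1 ⟨c4, h⟩).trans ((A4 _).1 ⟨x4, x5⟩).symm)
    have := U 1 5 (by omega) (by omega) _ _ u1 u5 c1 c5
    exact c0 (this ▸ u0)
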